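/- Let d ≥ 4 be an integer and let P ⊂ ℝ^d be a canonical Fano polytope such that P = conv(S_1 ∪ S_2), where S_1 and S_2 are (d − 1)-dimensional simplices with vertices in vert(P), each containing 0 in its relative interior, sharing exactly d − 2 vertices (i.e. |vert(S_1) ∩ vert(S_2)| = d − 2). Then vol(P*) < 2(s_d − 1)^2 / d!. -/

import Mathlib

open MeasureTheory Set
open scoped ENNReal

/-- The Sylvester sequence, 0-indexed: `sylvester 0 = 2 = s₁`,
`sylvester (n+1) = (sylvester n)^2 - sylvester n + 1`, so that `sₙ = sylvester (n-1)`. -/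
def sylvester : ℕ → ℕ
  | 0 => 2
  | n + 1 => (sylvester n) ^ 2 - sylvester n + 1

/-- A point of `ℝ^d` is a lattice point if all its coordinates are integers. -/
def IsLatticePt {d : ℕ} (x : Fin d → ℝ) : Prop := ∀ i, ∃ z : ℤ, x i = (z : ℝ)

/-- A lattice polytope: the convex hull of finitely many lattice points. -/
def IsLatticePolytope {d : ℕ} (P : Set (Fin d → ℝ)) : Prop :=
  ∃ V : Finset (Fin d → ℝ), (∀ v ∈ V, IsLatticePt v) ∧ P = convexHull ℝ (V : Set (Fin d → ℝ))

/-- A canonical Fano polytope in `ℝ^d`: a lattice polytope (automatically of full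
dimension `d`) whose interior contains exactly one lattice point, namely the origin. -/
def IsCanonicalFano {d : ℕ} (P : Set (Fin d → ℝ)) : Prop :=
  IsLatticePolytope P ∧ {x ∈ interior P | IsLatticePt x} = {0}

/-- The dual (polar) of a set `P ⊆ ℝ^d`: all `y` with `⟨y, x⟩ ≥ -1` for every `x ∈ P`. -/
def polarDual {d : ℕ} (P : Set (Fin d → ℝ)) : Set (Fin d → ℝ) :=
  {y | ∀ x ∈ P, -1 ≤ ∑ i, y i * x i}

/-- A simplex of dimension `k` in `ℝ^d`: the convex hull of `k + 1` affinely
independent points. -/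
def IsSimplexOfDim {d : ℕ} (k : ℕ) (S : Set (Fin d → ℝ)) : Prop :=
  ∃ f : Fin (k + 1) → (Fin d → ℝ), AffineIndependent ℝ f ∧ S = convexHull ℝ (Set.range f)

/-- A canonical Fano polytope of dimension `k` with respect to the lattice
`lin(S) ∩ ℤ^d`: a lattice polytope of dimension `k` whose relative interior contains
exactly one lattice point, namely the origin. -/
def IsCanonicalFanoOfDim {d : ℕ} (k : ℕ) (S : Set (Fin d → ℝ)) : Prop :=
  IsLatticePolytope S ∧ Module.finrank ℝ ↥(vectorSpan ℝ S) = k ∧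
    {x ∈ intrinsicInterior ℝ S | IsLatticePt x} = {0}

/-- Minimality for canonical Fano polytopes of dimension `k` (w.r.t. `lin(S) ∩ ℤ^d`):
removing any vertex destroys the property. -/
def IsMinimalCanonicalFanoOfDim {d : ℕ} (k : ℕ) (S : Set (Fin d → ℝ)) : Prop :=
  IsCanonicalFanoOfDim k S ∧ ∀ v ∈ Set.extremePoints ℝ S,
    ¬ IsCanonicalFanoOfDim k (convexHull ℝ ({x ∈ S | IsLatticePt x} \ {v}))

/-- A minimal (full-dimensional) canonical Fano polytope in `ℝ^d`: removing any vertex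
destroys the property of being a `d`-dimensional canonical Fano polytope. -/
def IsMinimalCanonicalFano {d : ℕ} (P : Set (Fin d → ℝ)) : Prop :=
  IsCanonicalFano P ∧ ∀ v ∈ Set.extremePoints ℝ P,
    ¬ IsCanonicalFano (convexHull ℝ ({x ∈ P | IsLatticePt x} \ {v}))

open Finset in
theorem sum_sub_sum_le_mul_log {x y : ℕ → ℝ} {n : ℕ} (hx : ∀ i < n, 0 < x i)
    (hy : ∀ i < n, 0 < y i) (hanti : ∀ i j, i ≤ j → j < n → x j ≤ x i)
    (H : ∀ m < n, ∏ i ∈ range m, y i < ∏ i ∈ range m, x i →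
      ∑ i ∈ range m, x i < ∑ i ∈ range m, y i) :
    ∀ l ≤ n, ∀ c : ℝ, 0 < c → (∀ i < l, c ≤ x i) →
      ∏ i ∈ range l, x i ≤ ∏ i ∈ range l, y i →
      (∑ i ∈ range l, x i - ∑ i ∈ range l, y i ≤
        c * (Real.log (∏ i ∈ range l, x i) - Real.log (∏ i ∈ range l, y i))) ∧
      (∑ i ∈ range l, x i - ∑ i ∈ range l, y i =
        c * (Real.log (∏ i ∈ range l, x i) - Real.log (∏ i ∈ range l, y i)) →
          ∀ i < l, x i = y i) := by
  intro l
  induction l with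
  | zero => intro _ c _ _ _; simp
  | succ l ih =>
    intro hl c hc hcx hle
    have hxl := hx l (by omega)
    have hyl := hy l (by omega)
    have hX : 0 < ∏ i ∈ range l, x i :=
      prod_pos fun i hi => hx i (by rw [Finset.mem_range] at hi; omega)
    have hY : 0 < ∏ i ∈ range l, y i :=
      prod_pos fun i hi => hy i (by rw [Finset.mem_range] at hi; omega)
    have hlog : Real.log (∏ i ∈ range (l + 1), x i) ≤ Real.log (∏ i ∈ range (l + 1), y i) :=
      Real.log_le_log (prod_pos fun i hi => hx i (by rw [Finset.mem_range] at hi; omega)) hle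
    rw [prod_range_succ, prod_range_succ, Real.log_mul hX.ne' hxl.ne',
      Real.log_mul hY.ne' hyl.ne'] at hlog ⊢
    rw [sum_range_succ, sum_range_succ]
    have hb : x l - y l ≤ x l * (Real.log (x l) - Real.log (y l)) := by
      have := Real.log_le_sub_one_of_pos (div_pos hyl hxl)
      rw [Real.log_div hyl.ne' hxl.ne'] at this
      have h2 := mul_le_mul_of_nonneg_left this hxl.le
      have h3 : x l * (y l / x l - 1) = y l - x l := by field_simp
      linarith
    have hb' : x l - y l = x l * (Real.log (x l) - Real.log (y l)) → x l = y l := by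
      intro he
      by_contra hne
      have h1 : y l / x l ≠ 1 := fun h => hne ((div_eq_one_iff_eq hxl.ne').1 h).symm
      have := Real.log_lt_sub_one_of_pos (div_pos hyl hxl) h1
      rw [Real.log_div hyl.ne' hxl.ne'] at this
      have h2 := mul_lt_mul_of_pos_left this hxl
      have h3 : x l * (y l / x l - 1) = y l - x l := by field_simp
      linarith
    have hcl := hcx l (by omega)
    set A := Real.log (∏ i ∈ range l, x i)
    set B := Real.log (∏ i ∈ range l, y i)
    have hmono : x l * (A + Real.log (x l) - (B + Real.log (y l))) ≤
        c * (A + Real.log (x l) - (B + Real.log (y l))) :=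
      mul_le_mul_of_nonpos_right hcl (by linarith)
    rcases le_or_gt (∏ i ∈ range l, x i) (∏ i ∈ range l, y i) with h | h
    · obtain ⟨h1, h2⟩ := ih (by omega) (x l) hxl (fun i hi => hanti i l hi.le (by omega)) h
      refine ⟨by linarith, fun he i hi => ?_⟩
      rcases Nat.lt_succ_iff_lt_or_eq.1 hi with hi | rfl
      · exact h2 (by linarith) i hi
      · exact hb' (by linarith)
    · have h1 := H l (by omega) h
      have h2 : B < A := Real.log_lt_log hY h
      have h3 := mul_pos hxl (sub_pos.2 h2)
      exact ⟨by linarith, fun he => absurd he (by linarith)⟩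

theorem two_le_sylvester (n : ℕ) : 2 ≤ sylvester n := by
  induction n with
  | zero => rfl
  | succ n ih =>
    have h : 2 * sylvester n ≤ sylvester n ^ 2 := by rw [sq]; gcongr
    rw [sylvester]
    omega

theorem cast_sylvester_succ (n : ℕ) :
    (sylvester (n + 1) : ℝ) = sylvester n ^ 2 - sylvester n + 1 := by
  rw [sylvester, Nat.cast_add, Nat.cast_sub (Nat.le_self_pow two_ne_zero _)]
  simp

theorem two_le_cast_sylvester (n : ℕ) : (2 : ℝ) ≤ sylvester n := by
  exact_mod_cast two_le_sylvester n

theorem sylvester_strictMono : StrictMono sylvester := by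
  refine strictMono_nat_of_lt_succ fun n => ?_
  have h := two_le_cast_sylvester n
  have : (sylvester n : ℝ) < sylvester (n + 1) := by
    rw [cast_sylvester_succ]
    nlinarith
  exact_mod_cast this

theorem prod_range_inv_sylvester (n : ℕ) :
    ∏ i ∈ Finset.range n, (sylvester i : ℝ)⁻¹ = ((sylvester n : ℝ) - 1)⁻¹ := by
  induction n with
  | zero => norm_num [sylvester]
  | succ n ih =>
    rw [Finset.prod_range_succ, ih, cast_sylvester_succ, ← mul_inv]
    ring_nf

theorem sum_range_inv_sylvester (n : ℕ) :
    ∑ i ∈ Finset.range n, (sylvester i : ℝ)⁻¹ = 1 - ((sylvester n : ℝ) - 1)⁻¹ := by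
  induction n with
  | zero => norm_num [sylvester]
  | succ n ih =>
    have h := two_le_cast_sylvester n
    have h0 : (sylvester n : ℝ) ≠ 0 := by linarith
    have h1 : (sylvester n : ℝ) - 1 ≠ 0 := by linarith
    rw [Finset.sum_range_succ, ih, cast_sylvester_succ,
      show (sylvester n : ℝ) ^ 2 - sylvester n + 1 - 1 = sylvester n * (sylvester n - 1) by ring]
    field_simp
    ring

/-- The extremal weights `1/s₁, …, 1/s_N, 1/(s_{N+1} - 1)`. -/
noncomputable def sylvesterWeight (N i : ℕ) : ℝ :=
  if i < N then (sylvester i : ℝ)⁻¹ else ((sylvester N : ℝ) - 1)⁻¹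

theorem sylvesterWeight_pos (N i : ℕ) : 0 < sylvesterWeight N i := by
  have h1 := two_le_cast_sylvester i
  have h2 := two_le_cast_sylvester N
  unfold sylvesterWeight
  split_ifs
  · exact inv_pos.2 (by linarith)
  · exact inv_pos.2 (by linarith)

theorem sum_range_sylvesterWeight {N m : ℕ} (h : m ≤ N) :
    ∑ i ∈ Finset.range m, sylvesterWeight N i = 1 - ((sylvester m : ℝ) - 1)⁻¹ := by
  rw [← sum_range_inv_sylvester]
  refine Finset.sum_congr rfl fun i hi => if_pos ?_
  rw [Finset.mem_range] at hi
  omega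

theorem prod_range_sylvesterWeight {N m : ℕ} (h : m ≤ N) :
    ∏ i ∈ Finset.range m, sylvesterWeight N i = ((sylvester m : ℝ) - 1)⁻¹ := by
  rw [← prod_range_inv_sylvester]
  refine Finset.prod_congr rfl fun i hi => if_pos ?_
  rw [Finset.mem_range] at hi
  omega

theorem sylvesterWeight_lt {N i j : ℕ} (hN : 2 ≤ N) (hij : i < j) (hj : j ≤ N) :
    sylvesterWeight N j < sylvesterWeight N i := by
  have hi := two_le_cast_sylvester i
  have hiN : i < N := by omega
  unfold sylvesterWeight
  rw [if_pos hiN]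
  split_ifs with h
  · have : (sylvester i : ℝ) < sylvester j := by exact_mod_cast sylvester_strictMono hij
    gcongr
  · obtain ⟨M, rfl⟩ : ∃ M, N = M + 1 := ⟨N - 1, by omega⟩
    have h1 : (sylvester i : ℝ) ≤ sylvester M := by
      exact_mod_cast sylvester_strictMono.monotone (by omega : i ≤ M)
    have h2 : (2 : ℝ) < sylvester M := by
      exact_mod_cast sylvester_strictMono (by omega : 0 < M)
    rw [cast_sylvester_succ]
    gcongr
    nlinarith

theorem prod_lower_bound {N : ℕ} (hN : 2 ≤ N) {β : Fin (N + 1) → ℝ} (hpos : ∀ i, 0 < β i)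
    (hsum : ∑ i, β i = 1)
    (H : ∀ s : Finset (Fin (N + 1)), s ≠ Finset.univ → ∏ i ∈ s, β i ≤ 1 - ∑ i ∈ s, β i) :
    (((sylvester N : ℝ) - 1) ^ 2)⁻¹ < ∏ i, β i ∨
      ((((sylvester N : ℝ) - 1) ^ 2)⁻¹ = ∏ i, β i ∧ Function.Injective β) := by
  set σ := Tuple.sort fun i => -β i
  have hσ : Monotone ((fun i => -β i) ∘ σ) := Tuple.monotone_sort _
  set x : ℕ → ℝ := fun i => if h : i < N + 1 then β (σ ⟨i, h⟩) else 0 with hxdef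
  have hx (i : ℕ) (h : i < N + 1) : x i = β (σ ⟨i, h⟩) := dif_pos h
  have hprefix (m : ℕ) (hm : m < N + 1) :
      ∏ i ∈ Finset.range m, x i ≤ 1 - ∑ i ∈ Finset.range m, x i := by
    have := H (Finset.univ.map ((Fin.castLEEmb hm.le).trans σ.toEmbedding)) (by
      intro h
      have := congrArg Finset.card h
      simp at this
      omega)
    rw [Finset.prod_map, Finset.sum_map] at this
    have e (i : Fin m) : x i = β (((Fin.castLEEmb hm.le).trans σ.toEmbedding) i) :=
      hx i (by omega)
    rw [Finset.prod_range, Finset.sum_range]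
    simpa only [e] using this
  have hxprod : ∏ i ∈ Finset.range (N + 1), x i = ∏ i, β i := by
    rw [Finset.prod_range, ← Equiv.prod_comp σ β]
    exact Finset.prod_congr rfl fun i _ => hx i i.2
  have hxsum : ∑ i ∈ Finset.range (N + 1), x i = 1 := by
    rw [Finset.sum_range, ← hsum, ← Equiv.sum_comp σ β]
    exact Finset.sum_congr rfl fun i _ => hx i i.2
  have hyprod : ∏ i ∈ Finset.range (N + 1), sylvesterWeight N i =
      (((sylvester N : ℝ) - 1) ^ 2)⁻¹ := by
    rw [Finset.prod_range_succ, prod_range_sylvesterWeight le_rfl, sylvesterWeight,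
      if_neg (lt_irrefl N), sq, mul_inv]
  have hysum : ∑ i ∈ Finset.range (N + 1), sylvesterWeight N i = 1 := by
    rw [Finset.sum_range_succ, sum_range_sylvesterWeight le_rfl, sylvesterWeight,
      if_neg (lt_irrefl N)]
    ring
  have hxpos (i : ℕ) (h : i < N + 1) : 0 < x i := by rw [hx i h]; exact hpos _
  have hanti (i j : ℕ) (hij : i ≤ j) (hj : j < N + 1) : x j ≤ x i := by
    rw [hx i (by omega), hx j hj]
    have := hσ (show (⟨i, by omega⟩ : Fin (N + 1)) ≤ ⟨j, hj⟩ from hij)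
    simpa using this
  rw [or_iff_not_imp_left, not_lt]
  intro hle
  obtain ⟨h1, h2⟩ := sum_sub_sum_le_mul_log (x := x) (y := sylvesterWeight N) (n := N + 1) hxpos
    (fun i _ => sylvesterWeight_pos N i) hanti (fun m hm h => by
      rw [sum_range_sylvesterWeight (by omega)]
      rw [prod_range_sylvesterWeight (by omega)] at h
      linarith [hprefix m hm]) (N + 1) le_rfl (x N) (hxpos N (by omega))
      (fun i hi => hanti i N (by omega) (by omega)) (by rw [hxprod, hyprod]; exact hle)
  rw [hxprod, hyprod, hxsum, hysum, sub_self] at h1 h2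
  have hβ : 0 < ∏ i, β i := Finset.prod_pos fun i _ => hpos i
  have hlog : Real.log (∏ i, β i) ≤ Real.log (((sylvester N : ℝ) - 1) ^ 2)⁻¹ :=
    Real.log_le_log hβ hle
  have hN := hxpos N (by omega)
  have h3 : x N * (Real.log (∏ i, β i) - Real.log (((sylvester N : ℝ) - 1) ^ 2)⁻¹) ≤ 0 :=
    mul_nonpos_of_nonneg_of_nonpos hN.le (by linarith)
  have heq := h2 (by linarith)
  refine ⟨?_, ?_⟩
  · rw [← hyprod, ← hxprod]
    exact Finset.prod_congr rfl fun i hi => (heq i (Finset.mem_range.1 hi)).symm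
  · have hinj : Function.Injective (β ∘ σ) := by
      have hs : StrictAnti (β ∘ σ) := by
        intro i j hij
        have hi := (hx i i.2).symm.trans (heq i i.2)
        have hj := (hx j j.2).symm.trans (heq j j.2)
        have := sylvesterWeight_lt ‹2 ≤ N› (show (i : ℕ) < j from hij) (by omega)
        rwa [← hi, ← hj] at this
      exact hs.injective
    exact (σ.injective_comp β).1 hinj

/-- Minkowski's theorem for the body `|xᵢ - βᵢ ∑ x| < βᵢ`. -/
theorem exists_int_abs_sub_lt {κ : Type*} [Fintype κ] {β : κ → ℝ} (hpos : ∀ i, 0 < β i)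
    (hT : 0 < 1 - ∑ i, β i) (h : 1 - ∑ i, β i < ∏ i, β i) :
    ∃ a : κ → ℤ, a ≠ 0 ∧ ∀ i, |(a i : ℝ) - (∑ j, (a j : ℝ)) * β i| < β i := by
  classical
  set M : Matrix κ κ ℝ :=
    1 + Matrix.replicateCol Unit (-β) * Matrix.replicateRow Unit (fun _ => (1 : ℝ)) with hM
  have hdet : M.det = 1 - ∑ i, β i := by
    rw [hM, Matrix.det_one_add_replicateCol_mul_replicateRow]
    simp [dotProduct, sub_eq_add_neg]
  have hA (x : κ → ℝ) (i : κ) : Matrix.toLin' M x i = x i - (∑ j, x j) * β i := by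
    simp [hM, Matrix.mulVec, dotProduct, Matrix.mul_apply, mul_comm, sub_eq_add_neg,
      Finset.mul_sum]
  set b := Pi.basisFun ℝ κ
  set s : Set (κ → ℝ) := Matrix.toLin' M ⁻¹' Set.pi univ fun i => Ioo (-β i) (β i) with hs
  have hvol : volume s = ENNReal.ofReal ((1 - ∑ i, β i)⁻¹ * ∏ i, (2 * β i)) := by
    rw [hs, Measure.addHaar_preimage_linearMap _ (by
      rw [LinearMap.det_toLin', hdet]; exact hT.ne'), LinearMap.det_toLin', hdet, volume_pi_pi,
      abs_of_pos (inv_pos.2 hT), ENNReal.ofReal_mul (inv_pos.2 hT).le,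
      ENNReal.ofReal_prod_of_nonneg fun i _ => by have := hpos i; positivity]
    congr 1
    refine Finset.prod_congr rfl fun i _ => ?_
    rw [Real.volume_Ioo]
    congr 1
    ring
  have hconv : Convex ℝ s :=
    (convex_pi fun i _ => convex_Ioo _ _).linear_preimage (Matrix.toLin' M)
  have hsymm : ∀ x ∈ s, -x ∈ s := by
    intro x hx i hi
    have := hx i hi
    rw [map_neg, Pi.neg_apply]
    exact ⟨neg_lt_neg this.2, by linarith [this.1]⟩
  have : Countable (Submodule.span ℤ (range b)).toAddSubgroup :=
    inferInstanceAs (Countable (Submodule.span ℤ (range b)))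
  obtain ⟨⟨x, hxL⟩, hx0, hxs⟩ := exists_ne_zero_mem_lattice_of_measure_mul_two_pow_lt_measure
    (ZSpan.isAddFundamentalDomain' b volume) hsymm hconv (by
      rw [ZSpan.fundamentalDomain_pi_basisFun, volume_pi_pi, hvol]
      simp only [Real.volume_Ico, sub_zero, ENNReal.ofReal_one, Finset.prod_const_one, one_mul,
        Module.finrank_fintype_fun_eq_card]
      rw [Finset.prod_mul_distrib, Finset.prod_const, Finset.card_univ,
        show (2 : ℝ≥0∞) ^ Fintype.card κ = ENNReal.ofReal (2 ^ Fintype.card κ) by simp]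
      refine (ENNReal.ofReal_lt_ofReal_iff_of_nonneg (by positivity)).2 ?_
      rw [inv_mul_eq_div, lt_div_iff₀ hT]
      gcongr)
  have hint : ∀ i, ∃ z : ℤ, (z : ℝ) = x i := by
    have := (b.mem_span_iff_repr_mem ℤ x).1 hxL
    intro i
    obtain ⟨z, hz⟩ := this i
    exact ⟨z, by simpa [b] using hz⟩
  choose a ha using hint
  refine ⟨a, ?_, fun i => ?_⟩
  · rintro rfl
    refine hx0 (Subtype.ext (funext fun i => ?_))
    simpa using (ha i).symm
  · have := hxs i (mem_univ i)
    rw [hA] at this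
    simp only [ha]
    exact abs_lt.2 this

theorem prod_le_of_forall_int {ι : Type*} [Fintype ι] {β : ι → ℝ} (hpos : ∀ i, 0 < β i)
    (hsum : ∑ i, β i = 1)
    (H : ∀ a : ι → ℤ, (∀ i, 0 < β i + (∑ j, (a j : ℝ)) * β i - a i) →
      ∀ i, (∑ j, (a j : ℝ)) * β i = a i)
    (s : Finset ι) (hs : s ≠ Finset.univ) : ∏ i ∈ s, β i ≤ 1 - ∑ i ∈ s, β i := by
  classical
  by_contra! hlt
  have hT : 0 < 1 - ∑ i ∈ s, β i := by
    rw [← hsum, ← Finset.sum_compl_add_sum s, add_sub_cancel_right]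
    refine Finset.sum_pos (fun i _ => hpos i) ?_
    rwa [Finset.nonempty_iff_ne_empty, Ne, Finset.compl_eq_empty_iff]
  obtain ⟨i₀, hi₀⟩ : ∃ i, i ∉ s := by
    by_contra! h
    exact hs (Finset.eq_univ_iff_forall.2 h)
  obtain ⟨a, ha0, ha⟩ := exists_int_abs_sub_lt (κ := s) (β := fun i => β i) (fun i => hpos i)
    (by rwa [Finset.sum_coe_sort s]) (by rwa [Finset.sum_coe_sort s, Finset.prod_coe_sort s])
  have key : ∀ a : s → ℤ, a ≠ 0 → 0 ≤ ∑ j, (a j : ℝ) →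
      ¬ ∀ i : s, |(a i : ℝ) - (∑ j, (a j : ℝ)) * β i| < β i := by
    intro a ha0 hnn ha
    set a' : ι → ℤ := fun i => if h : i ∈ s then a ⟨i, h⟩ else 0 with ha'
    have e1 (i : s) : a' i = a i := by simp [ha']
    have e2 (i : ι) (hi : i ∉ s) : a' i = 0 := by simp [ha', hi]
    have e3 : ∑ j, (a' j : ℝ) = ∑ j, (a j : ℝ) := by
      rw [← Finset.sum_subset (Finset.subset_univ s) (fun i _ hi => by rw [e2 i hi, Int.cast_zero]),
        ← Finset.sum_coe_sort s]
      exact Finset.sum_congr rfl fun i _ => by rw [e1]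
    have h := H a' (fun i => by
      rw [e3]
      by_cases hi : i ∈ s
      · have h1 := (abs_lt.1 (ha ⟨i, hi⟩)).2
        have h2 := e1 ⟨i, hi⟩
        simp only at h1 h2
        rw [h2]
        linarith
      · rw [e2 i hi, Int.cast_zero, sub_zero]
        have := hpos i
        positivity)
    rw [e3] at h
    have hz : ∑ j, (a j : ℝ) = 0 := by
      have := h i₀
      rw [e2 i₀ hi₀, Int.cast_zero] at this
      exact (mul_eq_zero.1 this).resolve_right (hpos i₀).ne'
    refine ha0 (funext fun i => ?_)
    have := h i
    rw [hz, zero_mul, e1] at this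
    exact_mod_cast this.symm
  rcases le_total 0 (∑ j, (a j : ℝ)) with h | h
  · exact key a ha0 h ha
  · refine key (-a) (neg_ne_zero.2 ha0) (by simpa using h) fun i => ?_
    have := ha i
    rw [← abs_neg] at this
    convert this using 2
    simp
    ring

theorem lintegral_fin_succ {n : ℕ} {F : (Fin (n + 1) → ℝ) → ℝ≥0∞} (hF : Measurable F) :
    ∫⁻ t, F t = ∫⁻ z : Fin n → ℝ, ∫⁻ s : ℝ, F (Fin.cons s z) := by
  rw [← ((volume_preserving_piFinSuccAbove (fun _ : Fin (n + 1) => ℝ) 0).symm _).lintegral_comp hF]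
  refine (lintegral_prod_symm' _ (hF.comp (MeasurableEquiv.measurable _))).trans ?_
  simp [MeasurableEquiv.piFinSuccAbove, Fin.insertNthEquiv]

theorem lintegral_indicator_Ici_max_pow {b : ℝ} (hb : 0 < b) (c : ℝ) {k : ℕ} (hk : k ≠ 0) :
    ∫⁻ s : ℝ, (Ici 0).indicator (fun s => ENNReal.ofReal (max (c - b * s) 0 ^ k)) s =
      ENNReal.ofReal (max c 0 ^ (k + 1) / ((k + 1) * b)) := by
  rcases le_or_gt c 0 with hc | hc
  · rw [max_eq_right hc, zero_pow (by omega), zero_div, ENNReal.ofReal_zero]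
    refine (lintegral_congr fun s => ?_).trans lintegral_zero
    refine indicator_apply_eq_zero.2 fun hs => ?_
    have : b * s ≥ 0 := mul_nonneg hb.le hs
    rw [max_eq_right (by linarith), zero_pow hk, ENNReal.ofReal_zero]
  · have hcb : 0 ≤ c / b := by positivity
    have h1 : ((Ici 0).indicator fun s => ENNReal.ofReal (max (c - b * s) 0 ^ k)) =
        (Icc 0 (c / b)).indicator fun s => ENNReal.ofReal ((c - b * s) ^ k) := by
      ext s
      simp only [indicator_apply, mem_Ici, mem_Icc, le_div_iff₀ hb]
      by_cases h0 : 0 ≤ s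
      · by_cases h1 : s * b ≤ c
        · rw [if_pos h0, if_pos ⟨h0, h1⟩, max_eq_left (by linarith)]
        · rw [if_pos h0, if_neg (by tauto), max_eq_right (by linarith), zero_pow hk,
            ENNReal.ofReal_zero]
      · rw [if_neg h0, if_neg (by tauto)]
    rw [h1, lintegral_indicator measurableSet_Icc, ← ofReal_integral_eq_lintegral_ofReal,
      integral_Icc_eq_integral_Ioc, ← intervalIntegral.integral_of_le hcb,
      intervalIntegral.integral_comp_sub_mul (fun x => x ^ k) hb.ne', integral_pow,
      max_eq_left hc.le]
    · congr 1
      rw [mul_div_cancel₀ c hb.ne']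
      simp
      field_simp
    · exact (Continuous.continuousOn (by fun_prop)).integrableOn_Icc
    · refine (ae_restrict_iff' measurableSet_Icc).2 (ae_of_all _ fun s hs => ?_)
      have := (le_div_iff₀ hb).1 hs.2
      exact pow_nonneg (by linarith) k

theorem measurable_indicator_max_pow {n : ℕ} (β : Fin n → ℝ) (c : ℝ) (k : ℕ) :
    Measurable ({z : Fin n → ℝ | ∀ i, 0 ≤ z i}.indicator
      fun z => ENNReal.ofReal (max (c - ∑ i, β i * z i) 0 ^ k)) := by
  refine Measurable.indicator ?_ ?_
  · exact (Measurable.max (by fun_prop) (by fun_prop)).pow_const k |>.ennreal_ofReal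
  · exact (measurableSet_le measurable_const measurable_id : MeasurableSet {z : Fin n → ℝ | 0 ≤ z})

theorem lintegral_indicator_max_pow {n : ℕ} {β : Fin n → ℝ} (hβ : ∀ i, 0 < β i) (c : ℝ) {k : ℕ}
    (hk : k ≠ 0) :
    ∫⁻ z : Fin n → ℝ, {z : Fin n → ℝ | ∀ i, 0 ≤ z i}.indicator
      (fun z => ENNReal.ofReal (max (c - ∑ i, β i * z i) 0 ^ k)) z =
      ENNReal.ofReal (k.factorial * max c 0 ^ (n + k) / ((n + k).factorial * ∏ i, β i)) := by
  induction n generalizing k with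
  | zero =>
    rw [volume_pi, Measure.pi_of_empty, lintegral_dirac' _ (measurable_indicator_max_pow β c k)]
    rw [indicator_of_mem (by exact fun i => i.elim0)]
    congr 1
    simp only [Finset.univ_eq_empty, Finset.sum_empty, Finset.prod_empty, sub_zero, zero_add,
      mul_one]
    rw [mul_div_cancel_left₀ _ (by positivity)]
  | succ n ih =>
    have hmeas := measurable_indicator_max_pow β c k
    rw [lintegral_fin_succ hmeas]
    have h0 := hβ 0
    have h1 (z : Fin n → ℝ) : ∫⁻ s : ℝ, {z : Fin (n + 1) → ℝ | ∀ i, 0 ≤ z i}.indicator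
        (fun z => ENNReal.ofReal (max (c - ∑ i, β i * z i) 0 ^ k)) (Fin.cons s z) =
        ENNReal.ofReal (((k + 1) * β 0)⁻¹) * {z : Fin n → ℝ | ∀ i, 0 ≤ z i}.indicator
        (fun z => ENNReal.ofReal (max (c - ∑ i, β i.succ * z i) 0 ^ (k + 1))) z := by
      by_cases hz : ∀ i, 0 ≤ z i
      · rw [indicator_of_mem (by exact hz), ← ENNReal.ofReal_mul (by positivity), inv_mul_eq_div,
          ← lintegral_indicator_Ici_max_pow h0 _ hk]
        refine lintegral_congr fun s => ?_
        simp only [indicator_apply, mem_ofPred_eq, Fin.forall_fin_succ, Fin.cons_zero,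
          Fin.cons_succ, hz, implies_true, and_true, mem_Ici, Fin.sum_univ_succ]
        congr 4
        ring
      · rw [indicator_of_notMem (by exact hz), mul_zero]
        refine (lintegral_congr fun s => ?_).trans lintegral_zero
        refine indicator_of_notMem (fun h => hz fun i => ?_) _
        simpa using h i.succ
    rw [lintegral_congr h1, lintegral_const_mul _ (measurable_indicator_max_pow _ c _),
      ih (fun i => hβ i.succ) (Nat.succ_ne_zero k), ← ENNReal.ofReal_mul (by positivity)]
    congr 1
    have hp : ∏ i : Fin n, β i.succ ≠ 0 := (Finset.prod_pos fun i _ => hβ i.succ).ne'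
    rw [Fin.prod_univ_succ, show n + 1 + k = n + (k + 1) by ring, Nat.factorial_succ k]
    push_cast
    field_simp

theorem volume_double_pyramid_le {n : ℕ} {β γ : Fin n → ℝ} {b c : ℝ} (hβ : ∀ i, 0 < β i)
    (hγ : ∀ i, 0 < γ i) (hb : 0 < b) (hc : 0 < c) :
    volume {t : Fin (n + 2) → ℝ | (∀ i, 0 ≤ t i) ∧ b * t 0 + ∑ i, β i * t i.succ.succ ≤ 1 ∧
      c * t 1 + ∑ i, γ i * t i.succ.succ ≤ 1} ≤
    ENNReal.ofReal (((b ^ 2 * ∏ i, β i)⁻¹ + (c ^ 2 * ∏ i, γ i)⁻¹) / (n + 2).factorial) := by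
  set R := {t : Fin (n + 2) → ℝ | (∀ i, 0 ≤ t i) ∧ b * t 0 + ∑ i, β i * t i.succ.succ ≤ 1 ∧
      c * t 1 + ∑ i, γ i * t i.succ.succ ≤ 1} with hR
  have hRm : MeasurableSet R := by
    refine (measurableSet_le measurable_const measurable_id :
      MeasurableSet {t : Fin (n + 2) → ℝ | 0 ≤ t}).inter ?_
    have hm (b : ℝ) (β : Fin n → ℝ) (j : Fin (n + 2)) : MeasurableSet
        {t : Fin (n + 2) → ℝ | b * t j + ∑ i, β i * t i.succ.succ ≤ 1} :=
      measurableSet_le (by fun_prop) measurable_const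
    exact (hm b β 0).inter (hm c γ 1)
  have hF : Measurable (R.indicator (1 : (Fin (n + 2) → ℝ) → ℝ≥0∞)) := measurable_one.indicator hRm
  have hG : Measurable fun z : Fin (n + 1) → ℝ => ∫⁻ s : ℝ, R.indicator
      (1 : (Fin (n + 2) → ℝ) → ℝ≥0∞) (Fin.cons s z) := by
    refine Measurable.lintegral_prod_right' (f := fun p : (Fin (n + 1) → ℝ) × ℝ =>
      R.indicator (1 : (Fin (n + 2) → ℝ) → ℝ≥0∞) (Fin.cons p.2 p.1)) (hF.comp ?_)
    refine measurable_pi_iff.2 fun i => ?_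
    refine Fin.cases ?_ (fun i => ?_) i
    · simpa using measurable_snd
    · exact (measurable_pi_apply i).comp measurable_fst
  rw [← lintegral_indicator_one hRm, lintegral_fin_succ hF, lintegral_fin_succ hG]
  set A := {z : Fin n → ℝ | ∀ i, 0 ≤ z i}
  have key (z : Fin n → ℝ) : ∫⁻ s : ℝ, ∫⁻ r : ℝ, R.indicator (1 : (Fin (n + 2) → ℝ) → ℝ≥0∞)
      (Fin.cons r (Fin.cons s z : Fin (n + 1) → ℝ)) ≤
      ENNReal.ofReal ((2 * b ^ 2)⁻¹) * A.indicator
        (fun z => ENNReal.ofReal (max (1 - ∑ i, β i * z i) 0 ^ 2)) z +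
      ENNReal.ofReal ((2 * c ^ 2)⁻¹) * A.indicator
        (fun z => ENNReal.ofReal (max (1 - ∑ i, γ i * z i) 0 ^ 2)) z := by
    by_cases hz : z ∈ A
    · set f := max (1 - ∑ i, β i * z i) 0
      set g := max (1 - ∑ i, γ i * z i) 0
      rw [indicator_of_mem hz, indicator_of_mem hz]
      calc ∫⁻ s : ℝ, ∫⁻ r : ℝ, R.indicator (1 : (Fin (n + 2) → ℝ) → ℝ≥0∞)
            (Fin.cons r (Fin.cons s z : Fin (n + 1) → ℝ))
          ≤ ∫⁻ s : ℝ, ∫⁻ r : ℝ, (Icc 0 (g / c)).indicator 1 s * (Icc 0 (f / b)).indicator 1 r := by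
            refine lintegral_mono fun s => lintegral_mono fun r => ?_
            by_cases h : (Fin.cons r (Fin.cons s z : Fin (n + 1) → ℝ) : Fin (n + 2) → ℝ) ∈ R
            · obtain ⟨h1, h2, h3⟩ := h
              have hr : 0 ≤ r := h1 0
              have hs : 0 ≤ s := h1 1
              have h2 : b * r + ∑ i, β i * z i ≤ 1 := h2
              have h3 : c * s + ∑ i, γ i * z i ≤ 1 := h3
              have hs' : s ∈ Icc 0 (g / c) := by
                refine ⟨hs, (le_div_iff₀ hc).2 ((le_max_left _ _).trans' ?_)⟩
                linarith
              have hr' : r ∈ Icc 0 (f / b) := by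
                refine ⟨hr, (le_div_iff₀ hb).2 ((le_max_left _ _).trans' ?_)⟩
                linarith
              rw [indicator_of_mem hs', indicator_of_mem hr']
              simp only [Pi.one_apply, mul_one]
              exact indicator_le_self R 1 _
            · rw [indicator_of_notMem h]
              exact zero_le
        _ = ENNReal.ofReal (g / c) * ENNReal.ofReal (f / b) := by
            simp_rw [lintegral_const_mul _ (measurable_one.indicator measurableSet_Icc)]
            rw [lintegral_mul_const _ (measurable_one.indicator measurableSet_Icc),
              lintegral_indicator_one measurableSet_Icc, lintegral_indicator_one measurableSet_Icc,
              Real.volume_Icc, Real.volume_Icc, sub_zero, sub_zero]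
        _ ≤ _ := by
            have hf : 0 ≤ f := le_max_right _ _
            have hg : 0 ≤ g := le_max_right _ _
            rw [← ENNReal.ofReal_mul (by positivity), ← ENNReal.ofReal_mul (by positivity),
              ← ENNReal.ofReal_mul (by positivity), ← ENNReal.ofReal_add (by positivity)
              (by positivity)]
            refine ENNReal.ofReal_le_ofReal ?_
            have h1 : (2 * b ^ 2)⁻¹ * f ^ 2 = (f / b) ^ 2 / 2 := by field_simp
            have h2 : (2 * c ^ 2)⁻¹ * g ^ 2 = (g / c) ^ 2 / 2 := by field_simp
            rw [h1, h2]
            nlinarith [sq_nonneg (f / b - g / c)]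
    · refine le_of_eq_of_le ?_ zero_le
      refine (lintegral_congr fun s => ?_).trans lintegral_zero
      refine (lintegral_congr fun r => ?_).trans lintegral_zero
      refine indicator_of_notMem (fun h => hz fun i => ?_) _
      exact h.1 i.succ.succ
  refine (lintegral_mono key).trans_eq ?_
  rw [lintegral_add_left ((measurable_indicator_max_pow _ _ _).const_mul _),
    lintegral_const_mul _ (measurable_indicator_max_pow _ _ _),
    lintegral_const_mul _ (measurable_indicator_max_pow _ _ _),
    lintegral_indicator_max_pow hβ _ two_ne_zero, lintegral_indicator_max_pow hγ _ two_ne_zero]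
  have hβ' : 0 < ∏ i, β i := Finset.prod_pos fun i _ => hβ i
  have hγ' : 0 < ∏ i, γ i := Finset.prod_pos fun i _ => hγ i
  rw [← ENNReal.ofReal_mul (by positivity), ← ENNReal.ofReal_mul (by positivity),
    ← ENNReal.ofReal_add (by positivity) (by positivity)]
  congr 1
  simp
  field_simp

theorem AffineIndependent.of_range_eq {ι κ E : Type*} [AddCommGroup E] [Module ℝ E] {f : ι → E}
    {g : κ → E} (hf : AffineIndependent ℝ f) (hg : Function.Injective g)
    (h : range g = range f) : AffineIndependent ℝ g := by
  have h1 := hf.range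
  rw [← h] at h1
  exact h1.comp_embedding ⟨rangeFactorization g, fun i j hij => hg (congrArg Subtype.val hij)⟩

theorem AffineIndependent.extremePoints_convexHull_range {ι E : Type*} [Finite ι]
    [NormedAddCommGroup E] [NormedSpace ℝ E] {f : ι → E} (hf : AffineIndependent ℝ f) :
    (convexHull ℝ (range f)).extremePoints ℝ = range f := by
  refine extremePoints_convexHull_subset.antisymm ?_
  rintro _ ⟨i, rfl⟩
  by_contra hi
  set X := (convexHull ℝ (range f)).extremePoints ℝ
  have hX : X ⊆ f '' (univ \ {i}) := by
    intro x hx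
    obtain ⟨j, rfl⟩ := extremePoints_convexHull_subset hx
    exact ⟨j, ⟨mem_univ _, by rintro rfl; exact hi hx⟩, rfl⟩
  have hfin : X.Finite := (finite_range f).subset extremePoints_convexHull_subset
  have hcl : IsClosed (convexHull ℝ X) := (hfin.isCompact_convexHull ℝ).isClosed
  have h1 : closure (convexHull ℝ X) = convexHull ℝ (range f) :=
    closure_convexHull_extremePoints ((finite_range f).isCompact_convexHull ℝ)
      (convex_convexHull ℝ (range f))
  rw [hcl.closure_eq] at h1
  have h2 : f i ∈ convexHull ℝ X := h1.symm ▸ subset_convexHull ℝ _ (mem_range_self i)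
  exact hf.notMem_affineSpan_sdiff i univ
    (affineSpan_mono ℝ hX (convexHull_subset_affineSpan X h2))

theorem exists_pos_weights_of_zero_mem_intrinsicInterior {ι E : Type*} [Fintype ι] [Nonempty ι]
    [NormedAddCommGroup E] [NormedSpace ℝ E] {g : ι → E}
    (h0 : (0 : E) ∈ intrinsicInterior ℝ (convexHull ℝ (range g))) :
    ∃ w : ι → ℝ, (∀ i, 0 < w i) ∧ ∑ i, w i = 1 ∧ ∑ i, w i • g i = 0 := by
  classical
  set S := convexHull ℝ (range g)
  have hmem (x : E) (hx : x ∈ S) : ∃ w : ι → ℝ, (∀ i, 0 ≤ w i) ∧ ∑ i, w i = 1 ∧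
      ∑ i, w i • g i = x := by
    rw [show S = convexHull ℝ (range g) from rfl, convexHull_range_eq_exists_affineCombination] at hx
    obtain ⟨s, w, hw, hs, rfl⟩ := hx
    refine ⟨fun i => if i ∈ s then w i else 0, fun i => ?_, ?_, ?_⟩
    · dsimp only
      split_ifs with h
      exacts [hw i h, le_rfl]
    · simpa using hs
    · rw [s.affineCombination_eq_linear_combination g w hs]
      simp [ite_smul]
  have hpoint (i : ι) : ∃ w : ι → ℝ, (∀ k, 0 ≤ w k) ∧ 0 < w i ∧ ∑ k, w k = 1 ∧
      ∑ k, w k • g k = 0 := by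
    obtain ⟨ε, hε, hεS⟩ : ∃ ε : ℝ, 0 < ε ∧ (-ε) • g i ∈ S := by
      obtain ⟨⟨x, hx⟩, hxint, hx0⟩ := h0
      simp only at hx0
      subst hx0
      have hgi : g i ∈ affineSpan ℝ S :=
        subset_affineSpan ℝ S (subset_convexHull ℝ _ (mem_range_self i))
      have hline (t : ℝ) : t • g i ∈ affineSpan ℝ S := by
        have := AffineMap.lineMap_mem t hx hgi
        simpa [AffineMap.lineMap_apply] using this
      have hcont : Continuous fun t : ℝ => (⟨t • g i, hline t⟩ : affineSpan ℝ S) := by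
        fun_prop
      have hnhds : ∀ᶠ t : ℝ in nhds 0, t • g i ∈ S := by
        have h1 : (Subtype.val ⁻¹' S : Set (affineSpan ℝ S)) ∈
            nhds (⟨(0 : ℝ) • g i, hline 0⟩ : affineSpan ℝ S) := by
          convert! mem_interior_iff_mem_nhds.1 hxint using 2
          exact Subtype.ext (zero_smul ℝ (g i))
        exact (hcont.tendsto 0) h1
      obtain ⟨r, hr, hball⟩ := Metric.eventually_nhds_iff.1 hnhds
      refine ⟨r / 2, by positivity, hball ?_⟩
      rw [Real.dist_eq, sub_zero, abs_neg, abs_of_pos (by positivity)]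
      linarith
    obtain ⟨w, hw0, hw1, hw⟩ := hmem _ hεS
    refine ⟨fun k => (1 + ε)⁻¹ * (w k + if k = i then ε else 0), fun k => ?_, ?_, ?_, ?_⟩
    · have := hw0 k
      dsimp only
      split_ifs <;> positivity
    · have := hw0 i
      dsimp only
      rw [if_pos rfl]
      positivity
    · rw [← Finset.mul_sum, Finset.sum_add_distrib, hw1]
      simp only [Finset.sum_ite_eq', Finset.mem_univ, if_true]
      field_simp
    · simp_rw [mul_smul, add_smul]
      rw [← Finset.smul_sum, Finset.sum_add_distrib, hw]
      simp [ite_smul]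
  choose w hw0 hwi hw1 hw using hpoint
  have hcard : (0 : ℝ) < Fintype.card ι := by exact_mod_cast Fintype.card_pos
  refine ⟨fun k => (Fintype.card ι : ℝ)⁻¹ * ∑ i, w i k, fun k => ?_, ?_, ?_⟩
  · exact mul_pos (inv_pos.2 hcard)
      (Finset.sum_pos' (fun i _ => hw0 i k) ⟨k, Finset.mem_univ _, hwi k⟩)
  · rw [← Finset.mul_sum, Finset.sum_comm]
    simp [hw1]
  · simp_rw [mul_smul, Finset.sum_smul]
    rw [← Finset.smul_sum, Finset.sum_comm]
    simp [hw]

theorem mem_interior_of_pos_weights {ι E : Type*} [Fintype ι] [NormedAddCommGroup E]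
    [NormedSpace ℝ E] {P : Set E} (hP : Convex ℝ P) (h0 : (0 : E) ∈ interior P) {g : ι → E}
    (hg : ∀ i, g i ∈ P) {w l : ι → ℝ} (hw1 : ∑ i, w i = 1)
    (hwg : ∑ i, w i • g i = 0) (hl : ∀ i, 0 < l i) (hl1 : ∑ i, l i = 1) :
    ∑ i, l i • g i ∈ interior P := by
  have hev : ∀ᶠ t : ℝ in nhds 0, ∀ i, 0 < l i - t * w i := by
    refine Filter.eventually_all.2 fun i => ?_
    have : Continuous fun t : ℝ => l i - t * w i := by fun_prop
    exact (this.tendsto 0).eventually (lt_mem_nhds (by simpa using hl i))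
  obtain ⟨r, hr, hball⟩ := Metric.eventually_nhds_iff.1 hev
  set t := min (r / 2) (1 / 2)
  have ht0 : 0 < t := by positivity
  have ht1 : t ≤ 1 / 2 := min_le_right _ _
  have hpos : ∀ i, 0 < l i - t * w i := by
    refine hball ?_
    rw [Real.dist_eq, sub_zero, abs_of_pos ht0]
    exact (min_le_left _ _).trans_lt (by linarith)
  have h1t : 0 < 1 - t := by linarith
  have hx : ∑ i, ((1 - t)⁻¹ * (l i - t * w i)) • g i ∈ P := by
    refine hP.sum_mem (fun i _ => (mul_pos (inv_pos.2 h1t) (hpos i)).le) ?_ fun i _ => hg i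
    rw [← Finset.mul_sum, Finset.sum_sub_distrib, ← Finset.mul_sum, hw1, hl1, mul_one,
      inv_mul_cancel₀ h1t.ne']
  have := hP.combo_interior_self_mem_interior h0 hx ht0 h1t.le (by ring)
  rw [smul_zero, zero_add, Finset.smul_sum] at this
  convert this using 1
  simp_rw [smul_smul, mul_inv_cancel_left₀ h1t.ne', sub_smul, mul_smul]
  rw [Finset.sum_sub_distrib, ← Finset.smul_sum, hwg, smul_zero, sub_zero]

theorem IsCanonicalFano.weights_eq_of_pos {d : ℕ} {P : Set (Fin d → ℝ)} (hP : IsCanonicalFano P)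
    {ι : Type*} [Fintype ι] {g : ι → Fin d → ℝ} (hind : AffineIndependent ℝ g)
    (hg : ∀ i, g i ∈ P) (hlat : ∀ i, IsLatticePt (g i)) {w : ι → ℝ} (hw1 : ∑ i, w i = 1)
    (hwg : ∑ i, w i • g i = 0) (a : ι → ℤ)
    (ha : ∀ i, 0 < w i + (∑ j, (a j : ℝ)) * w i - a i) (i : ι) :
    (∑ j, (a j : ℝ)) * w i = a i := by
  obtain ⟨⟨V, -, hV⟩, hint⟩ := hP
  have hconv : Convex ℝ P := hV ▸ convex_convexHull ℝ _
  have h0 : (0 : Fin d → ℝ) ∈ interior P := (hint.symm.subset (mem_singleton _)).1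
  have hx := mem_interior_of_pos_weights hconv h0 hg hw1 hwg ha (by
    rw [Finset.sum_sub_distrib, Finset.sum_add_distrib, ← Finset.mul_sum, hw1]
    ring)
  have hxe : ∑ i, (w i + (∑ j, (a j : ℝ)) * w i - a i) • g i = -∑ i, (a i : ℝ) • g i := by
    simp_rw [sub_smul, add_smul, mul_smul]
    rw [Finset.sum_sub_distrib, Finset.sum_add_distrib, ← Finset.smul_sum, hwg]
    simp
  rw [hxe] at hx
  choose z hz using hlat
  have hzero : -∑ i, (a i : ℝ) • g i = 0 := by
    refine hint.subset ⟨hx, fun k => ⟨-∑ i, a i * z i k, ?_⟩⟩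
    simp [hz, Finset.sum_apply]
  have := affineIndependent_iff.1 hind Finset.univ (fun i => (∑ j, (a j : ℝ)) * w i - a i)
    (by rw [Finset.sum_sub_distrib, ← Finset.mul_sum, hw1]; ring)
    (by
      simp_rw [sub_smul, mul_smul]
      rw [Finset.sum_sub_distrib, ← Finset.smul_sum, hwg, smul_zero, zero_sub, hzero]) i
    (Finset.mem_univ i)
  linarith

/-- The two vertices outside the common face can be ordered so that the weights satisfy a sharp
product bound. -/
theorem IsCanonicalFano.exists_weights {n : ℕ} (hn : 1 ≤ n) {P : Set (Fin (n + 2) → ℝ)}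
    (hP : IsCanonicalFano P) {a b : Fin (n + 2) → ℝ} {v : Fin n → Fin (n + 2) → ℝ}
    (hind : AffineIndependent ℝ (Fin.cons a (Fin.cons b v : Fin (n + 1) → Fin (n + 2) → ℝ) :
      Fin (n + 2) → Fin (n + 2) → ℝ))
    (ha : a ∈ P) (hb : b ∈ P) (hv : ∀ i, v i ∈ P) (hla : IsLatticePt a) (hlb : IsLatticePt b)
    (hlv : ∀ i, IsLatticePt (v i))
    (h0 : (0 : Fin (n + 2) → ℝ) ∈ intrinsicInterior ℝ (convexHull ℝ (range
      (Fin.cons a (Fin.cons b v : Fin (n + 1) → Fin (n + 2) → ℝ) :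
        Fin (n + 2) → Fin (n + 2) → ℝ)))) :
    ∃ (a' b' : Fin (n + 2) → ℝ) (p q : ℝ) (β : Fin n → ℝ),
      ((a' = a ∧ b' = b) ∨ (a' = b ∧ b' = a)) ∧ 0 < p ∧ 0 < q ∧ (∀ i, 0 < β i) ∧
      p + q + ∑ i, β i = 1 ∧ p • a' + q • b' + ∑ i, β i • v i = 0 ∧
      (p ^ 2 * ∏ i, β i)⁻¹ < ((sylvester (n + 1) : ℝ) - 1) ^ 2 := by
  set g : Fin (n + 2) → Fin (n + 2) → ℝ :=
    Fin.cons a (Fin.cons b v : Fin (n + 1) → Fin (n + 2) → ℝ) with hg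
  obtain ⟨w, hw0, hw1, hwg⟩ := exists_pos_weights_of_zero_mem_intrinsicInterior h0
  have hgP : ∀ i, g i ∈ P := by
    rw [Fin.forall_fin_succ, Fin.forall_fin_succ]
    exact ⟨ha, hb, hv⟩
  have hgl : ∀ i, IsLatticePt (g i) := by
    rw [Fin.forall_fin_succ, Fin.forall_fin_succ]
    exact ⟨hla, hlb, hlv⟩
  have hprod := prod_lower_bound (by omega) hw0 hw1 (prod_le_of_forall_int hw0 hw1
    (hP.weights_eq_of_pos hind hgP hgl hw1 hwg))
  have hs : 0 < ((sylvester (n + 1) : ℝ) - 1) ^ 2 := by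
    have := two_le_cast_sylvester (n + 1)
    have : 0 < (sylvester (n + 1) : ℝ) - 1 := by linarith
    positivity
  rw [Fin.sum_univ_succ, Fin.sum_univ_succ] at hw1 hwg
  rw [Fin.prod_univ_succ, Fin.prod_univ_succ] at hprod
  have h01 : (Fin.succ 0 : Fin (n + 2)) = 1 := rfl
  have hg0 : g 0 = a := rfl
  have hg1 : g 1 = b := rfl
  have hg2 (i : Fin n) : g i.succ.succ = v i := rfl
  simp only [h01, hg0, hg1, hg2] at hw1 hwg hprod
  have hβ : 0 < ∏ i : Fin n, w i.succ.succ := Finset.prod_pos fun i _ => hw0 _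
  have hp := hw0 0
  have hq := hw0 1
  have key (p q : ℝ) (hp : 0 < p) (hqp : q ≤ p)
      (h : (((sylvester (n + 1) : ℝ) - 1) ^ 2)⁻¹ < p * (q * ∏ i : Fin n, w i.succ.succ) ∨
        ((((sylvester (n + 1) : ℝ) - 1) ^ 2)⁻¹ = p * (q * ∏ i : Fin n, w i.succ.succ) ∧ q ≠ p)) :
      (p ^ 2 * ∏ i : Fin n, w i.succ.succ)⁻¹ < ((sylvester (n + 1) : ℝ) - 1) ^ 2 := by
    rw [inv_lt_comm₀ (by positivity) hs]
    have hpβ := mul_pos hp hβ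
    rcases h with h | ⟨h, hne⟩
    · nlinarith
    · have := lt_of_le_of_ne hqp hne
      nlinarith
  rcases le_total (w 1) (w 0) with hle | hle
  · refine ⟨a, b, w 0, w 1, fun i => w i.succ.succ, Or.inl ⟨rfl, rfl⟩, hp, hq, fun i => hw0 _,
      by rw [← hw1]; ring, by rw [← hwg]; abel, key _ _ hp hle ?_⟩
    exact hprod.imp_right fun h => ⟨h.1, fun he => by simpa using h.2 he⟩
  · refine ⟨b, a, w 1, w 0, fun i => w i.succ.succ, Or.inr ⟨rfl, rfl⟩, hq, hp, fun i => hw0 _,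
      by rw [← hw1]; ring, by rw [← hwg]; abel, key _ _ hq hle ?_⟩
    rw [mul_left_comm (w 1)]
    exact hprod.imp_right fun h => ⟨h.1, fun he => by simpa using h.2 he⟩

theorem exists_cons_cons_enumeration {α : Type*} {n : ℕ} {E : Set α} {v : Fin n → α}
    (hv : Function.Injective v) (hvE : range v ⊆ E) (hE : E.ncard = n + 2) :
    ∃ a b, Function.Injective (Fin.cons a (Fin.cons b v : Fin (n + 1) → α) : Fin (n + 2) → α) ∧
      range (Fin.cons a (Fin.cons b v : Fin (n + 1) → α) : Fin (n + 2) → α) = E := by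
  have hfin : E.Finite := finite_of_ncard_ne_zero (by omega)
  have hcard : (E \ range v).ncard = 2 := by
    rw [ncard_sdiff hvE (finite_range v), hE, ← image_univ, ncard_image_of_injective _ hv,
      ncard_univ, Nat.card_fin]
    omega
  obtain ⟨a, b, hab, hEv⟩ := ncard_eq_two.1 hcard
  have ha : a ∈ E \ range v := hEv.symm.subset (by simp)
  have hb : b ∈ E \ range v := hEv.symm.subset (by simp)
  refine ⟨a, b, Fin.cons_injective_iff.2 ⟨?_, Fin.cons_injective_iff.2 ⟨hb.2, hv⟩⟩, ?_⟩
  · rw [Fin.range_cons]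
    rintro (h | h)
    exacts [hab h, ha.2 h]
  · rw [Fin.range_cons, Fin.range_cons, ← sdiff_union_of_subset hvE, hEv]
    ext x
    simp [or_assoc]

theorem one_le_abs_det_of_isLatticePt {d : ℕ} {M : Matrix (Fin d) (Fin d) ℝ}
    (hM : ∀ i, IsLatticePt (M i)) (hdet : M.det ≠ 0) : 1 ≤ |M.det| := by
  choose z hz using hM
  have hMz : M = (Int.castRingHom ℝ).mapMatrix (Matrix.of z) := by
    ext i j
    simpa using hz i j
  have hd : M.det = ((Matrix.of z).det : ℤ) := by
    rw [hMz, ← RingHom.map_det, eq_intCast]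
  rw [hd] at hdet ⊢
  have := Int.one_le_abs (Int.cast_ne_zero.1 hdet)
  exact_mod_cast this

theorem volume_polarDual_le {n : ℕ} {P : Set (Fin (n + 2) → ℝ)} {a b c e : Fin (n + 2) → ℝ}
    {v : Fin n → Fin (n + 2) → ℝ} (hP : (interior P).Nonempty)
    (hPconv : P = convexHull ℝ ({a, b, c, e} ∪ range v))
    (hla : IsLatticePt a) (hlc : IsLatticePt c) (hlv : ∀ i, IsLatticePt (v i))
    {p q r s : ℝ} {β γ : Fin n → ℝ} (hp : 0 < p) (hq : 0 < q) (hr : 0 < r) (hs : 0 < s)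
    (hβ : ∀ i, 0 < β i) (hγ : ∀ i, 0 < γ i) (hβ1 : p + q + ∑ i, β i = 1)
    (hγ1 : r + s + ∑ i, γ i = 1) (hβ0 : p • a + q • b + ∑ i, β i • v i = 0)
    (hγ0 : r • c + s • e + ∑ i, γ i • v i = 0) :
    volume (polarDual P) ≤ ENNReal.ofReal
      (((p ^ 2 * ∏ i, β i)⁻¹ + (r ^ 2 * ∏ i, γ i)⁻¹) / (n + 2).factorial) := by
  have hsub : {a, b, c, e} ∪ range v ⊆ P := hPconv ▸ subset_convexHull ℝ _
  set M : Matrix (Fin (n + 2)) (Fin (n + 2)) ℝ :=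
    Matrix.of (Fin.cons a (Fin.cons c v : Fin (n + 1) → Fin (n + 2) → ℝ)) with hM
  have hspan : ⊤ ≤ Submodule.span ℝ (range M) := by
    have hmem (i) : M i ∈ Submodule.span ℝ (range M) := Submodule.subset_span (mem_range_self i)
    have ha : a ∈ Submodule.span ℝ (range M) := hmem 0
    have hc : c ∈ Submodule.span ℝ (range M) := hmem 1
    have hv (i) : v i ∈ Submodule.span ℝ (range M) := hmem i.succ.succ
    have aux {x y : Fin (n + 2) → ℝ} {p q : ℝ} {β : Fin n → ℝ} (hq : 0 < q)
        (h : p • x + q • y + ∑ i, β i • v i = 0) (hx : x ∈ Submodule.span ℝ (range M)) :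
        y ∈ Submodule.span ℝ (range M) := by
      rw [← Submodule.smul_mem_iff _ hq.ne',
        show q • y = -(p • x + ∑ i, β i • v i) by rw [eq_neg_iff_add_eq_zero, ← h]; abel]
      exact neg_mem (add_mem (Submodule.smul_mem _ _ hx)
        (sum_mem fun i _ => Submodule.smul_mem _ _ (hv i)))
    have hPs : P ⊆ Submodule.span ℝ (range M) := by
      rw [hPconv]
      refine convexHull_min ?_ (Submodule.convex _)
      rintro x ((rfl | rfl | rfl | rfl) | ⟨i, rfl⟩)
      exacts [ha, aux hq hβ0 ha, hc, aux hs hγ0 hc, hv i]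
    exact (Submodule.eq_top_of_nonempty_interior' _ (hP.mono (interior_mono hPs))).ge
  have hdet : M.det ≠ 0 := by
    have := linearIndependent_of_top_le_span_of_card_eq_finrank hspan (by simp)
    exact (M.isUnit_iff_isUnit_det.1 (Matrix.linearIndependent_rows_iff_isUnit.1 this)).ne_zero
  have habs := one_le_abs_det_of_isLatticePt (M := M) (by
    rw [Fin.forall_fin_succ, Fin.forall_fin_succ]
    exact ⟨hla, hlc, hlv⟩) hdet
  set R := {t : Fin (n + 2) → ℝ | (∀ i, 0 ≤ t i) ∧ p * t 0 + ∑ i, β i * t i.succ.succ ≤ 1 ∧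
      r * t 1 + ∑ i, γ i * t i.succ.succ ≤ 1} with hR
  have hincl : polarDual P ⊆ Matrix.toLin' M ⁻¹' ((fun x => x + 1) ⁻¹' R) := by
    intro y hy
    have hy' (x) (hx : x ∈ {a, b, c, e} ∪ range v) : -1 ≤ y ⬝ᵥ x := hy x (hsub hx)
    have hya := hy' a (by simp)
    have hyb := hy' b (by simp)
    have hyc := hy' c (by simp)
    have hye := hy' e (by simp)
    have hyv (i) := hy' (v i) (by simp)
    have e0 : (Matrix.toLin' M y + 1) 0 = y ⬝ᵥ a + 1 := by
      rw [dotProduct_comm]; rfl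
    have e1 : (Matrix.toLin' M y + 1) 1 = y ⬝ᵥ c + 1 := by
      rw [dotProduct_comm]; rfl
    have e2 (i : Fin n) : (Matrix.toLin' M y + 1) i.succ.succ = y ⬝ᵥ v i + 1 := by
      rw [dotProduct_comm]; rfl
    have aux {x z : Fin (n + 2) → ℝ} {p q : ℝ} {β : Fin n → ℝ} (hq : 0 < q)
        (h1 : p + q + ∑ i, β i = 1) (h : p • x + q • z + ∑ i, β i • v i = 0)
        (hz : -1 ≤ y ⬝ᵥ z) : p * (y ⬝ᵥ x + 1) + ∑ i, β i * (y ⬝ᵥ v i + 1) ≤ 1 := by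
      have h2 := congrArg (fun u => y ⬝ᵥ u) h
      simp only [dotProduct_add, dotProduct_smul, dotProduct_sum, dotProduct_zero,
        smul_eq_mul] at h2
      simp_rw [mul_add, mul_one]
      rw [Finset.sum_add_distrib]
      nlinarith
    refine ⟨?_, ?_, ?_⟩
    · rw [Fin.forall_fin_succ, Fin.forall_fin_succ]
      refine ⟨?_, ?_, fun i => ?_⟩
      · exact e0.ge.trans' (by linarith)
      · exact e1.ge.trans' (by linarith)
      · exact (e2 i).ge.trans' (by linarith [hyv i])
    · simp_rw [e0, e2]
      exact aux hq hβ1 hβ0 hyb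
    · simp_rw [e1, e2]
      exact aux hs hγ1 hγ0 hye
  calc volume (polarDual P)
      ≤ volume (Matrix.toLin' M ⁻¹' ((fun x => x + 1) ⁻¹' R)) := measure_mono hincl
    _ = ENNReal.ofReal |M.det⁻¹| * volume R := by
      rw [Measure.addHaar_preimage_linearMap _ (by rwa [LinearMap.det_toLin']),
        LinearMap.det_toLin', measure_preimage_add_right]
    _ ≤ 1 * volume R := by
      gcongr
      rw [ENNReal.ofReal_le_one, abs_inv]
      exact inv_le_one_of_one_le₀ habs
    _ ≤ _ := by
      rw [one_mul]
      exact volume_double_pyramid_le hβ hγ hp hr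

theorem volume_polarDual_lt {n : ℕ} (hn : 1 ≤ n) {P : Set (Fin (n + 2) → ℝ)}
    (hP : IsCanonicalFano P) {a b c e : Fin (n + 2) → ℝ} {v : Fin n → Fin (n + 2) → ℝ}
    (hPconv : P = convexHull ℝ ({a, b, c, e} ∪ range v))
    (hl : ∀ x ∈ {a, b, c, e} ∪ range v, IsLatticePt x)
    (hind1 : AffineIndependent ℝ (Fin.cons a (Fin.cons b v : Fin (n + 1) → Fin (n + 2) → ℝ) :
      Fin (n + 2) → Fin (n + 2) → ℝ))
    (hind2 : AffineIndependent ℝ (Fin.cons c (Fin.cons e v : Fin (n + 1) → Fin (n + 2) → ℝ) :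
      Fin (n + 2) → Fin (n + 2) → ℝ))
    (h01 : (0 : Fin (n + 2) → ℝ) ∈ intrinsicInterior ℝ (convexHull ℝ (range
      (Fin.cons a (Fin.cons b v : Fin (n + 1) → Fin (n + 2) → ℝ) :
        Fin (n + 2) → Fin (n + 2) → ℝ))))
    (h02 : (0 : Fin (n + 2) → ℝ) ∈ intrinsicInterior ℝ (convexHull ℝ (range
      (Fin.cons c (Fin.cons e v : Fin (n + 1) → Fin (n + 2) → ℝ) :
        Fin (n + 2) → Fin (n + 2) → ℝ)))) :
    volume (polarDual P) < ENNReal.ofReal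
      (2 * ((sylvester (n + 1) : ℝ) - 1) ^ 2 / ((n + 2).factorial : ℝ)) := by
  have hsub : {a, b, c, e} ∪ range v ⊆ P := hPconv ▸ subset_convexHull ℝ _
  have hint : (interior P).Nonempty := ⟨0, (hP.2.symm.subset (mem_singleton _)).1⟩
  have hlv (i) : IsLatticePt (v i) := hl _ (by simp)
  obtain ⟨a', b', p, q, β, hab, hp, hq, hβ, hβ1, hβ0, hβlt⟩ := hP.exists_weights hn hind1
    (hsub (by simp)) (hsub (by simp)) (fun i => hsub (by simp)) (hl _ (by simp)) (hl _ (by simp))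
    hlv h01
  obtain ⟨c', e', r, s, γ, hce, hr, hs, hγ, hγ1, hγ0, hγlt⟩ := hP.exists_weights hn hind2
    (hsub (by simp)) (hsub (by simp)) (fun i => hsub (by simp)) (hl _ (by simp)) (hl _ (by simp))
    hlv h02
  have hset : ({a, b, c, e} : Set (Fin (n + 2) → ℝ)) = {a', b', c', e'} := by
    rcases hab with ⟨rfl, rfl⟩ | ⟨rfl, rfl⟩ <;> rcases hce with ⟨rfl, rfl⟩ | ⟨rfl, rfl⟩ <;>
      first | rfl | (ext x; simp only [mem_insert_iff, mem_singleton_iff]; tauto)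
  rw [hset] at hPconv hl
  refine (volume_polarDual_le hint hPconv (hl _ (by simp)) (hl _ (by simp)) hlv hp hq hr hs hβ hγ
    hβ1 hγ1 hβ0 hγ0).trans_lt ?_
  have hβ' : 0 < ∏ i, β i := Finset.prod_pos fun i _ => hβ i
  have hγ' : 0 < ∏ i, γ i := Finset.prod_pos fun i _ => hγ i
  refine (ENNReal.ofReal_lt_ofReal_iff_of_nonneg (by positivity)).2 ?_
  gcongr
  linarith

/-- Let `d ≥ 4` and let `P ⊂ ℝ^d` be a canonical Fano polytope with
`P = conv(S₁ ∪ S₂)`, where `S₁, S₂` are `(d-1)`-dimensional simplices with vertices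
among `vert(P)`, each containing `0` in its relative interior, sharing exactly `d - 2`
vertices. Then `vol(P*) < 2(s_d - 1)^2 / d!`. -/
theorem dual_volume_lt_of_two_big_simplices (d : ℕ) (hd : 4 ≤ d)
    (P S1 S2 : Set (Fin d → ℝ))
    (hP : IsCanonicalFano P) (hPconv : P = convexHull ℝ (S1 ∪ S2))
    (hS1 : IsSimplexOfDim (d - 1) S1) (hS2 : IsSimplexOfDim (d - 1) S2)
    (h01 : (0 : Fin d → ℝ) ∈ intrinsicInterior ℝ S1)
    (h02 : (0 : Fin d → ℝ) ∈ intrinsicInterior ℝ S2)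
    (hsub1 : Set.extremePoints ℝ S1 ⊆ Set.extremePoints ℝ P)
    (hsub2 : Set.extremePoints ℝ S2 ⊆ Set.extremePoints ℝ P)
    (hshare : (Set.extremePoints ℝ S1 ∩ Set.extremePoints ℝ S2).ncard = d - 2) :
    volume (polarDual P) <
      ENNReal.ofReal (2 * ((sylvester (d - 1) : ℝ) - 1) ^ 2 / (d.factorial : ℝ)) := by
  obtain ⟨n, rfl⟩ : ∃ n, d = n + 2 := ⟨d - 2, by omega⟩
  obtain ⟨f1, hf1, rfl⟩ : ∃ f : Fin (n + 2) → Fin (n + 2) → ℝ,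
    AffineIndependent ℝ f ∧ S1 = convexHull ℝ (range f) := hS1
  obtain ⟨f2, hf2, rfl⟩ : ∃ f : Fin (n + 2) → Fin (n + 2) → ℝ,
    AffineIndependent ℝ f ∧ S2 = convexHull ℝ (range f) := hS2
  rw [hf1.extremePoints_convexHull_range] at hsub1 hshare
  rw [hf2.extremePoints_convexHull_range] at hsub2 hshare
  obtain ⟨V, hVl, hV⟩ := hP.1
  have hlat (x) (hx : x ∈ Set.extremePoints ℝ P) : IsLatticePt x := by
    rw [hV] at hx
    exact hVl x (extremePoints_convexHull_subset hx)
  have hcard {f : Fin (n + 2) → Fin (n + 2) → ℝ} (hf : AffineIndependent ℝ f) :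
      (range f).ncard = n + 2 := by
    rw [← image_univ, ncard_image_of_injective _ hf.injective, ncard_univ, Nat.card_fin]
  have hfin : (range f1 ∩ range f2).Finite := (finite_range f1).inter_of_left _
  obtain ⟨v, hvinj, hv⟩ : ∃ v : Fin n → Fin (n + 2) → ℝ, Function.Injective v ∧
      range v = range f1 ∩ range f2 := by
    have : Finite ↥(range f1 ∩ range f2) := hfin
    have e := Finite.equivFinOfCardEq (α := ↥(range f1 ∩ range f2)) (n := n) hshare
    refine ⟨fun i => e.symm i, Subtype.val_injective.comp e.symm.injective, ?_⟩
    exact (e.symm.surjective.range_comp Subtype.val).trans Subtype.range_val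
  obtain ⟨a, b, hinj1, hr1⟩ :=
    exists_cons_cons_enumeration hvinj (hv.trans_subset inter_subset_left) (hcard hf1)
  obtain ⟨c, e, hinj2, hr2⟩ :=
    exists_cons_cons_enumeration hvinj (hv.trans_subset inter_subset_right) (hcard hf2)
  have hunion : range f1 ∪ range f2 = {a, b, c, e} ∪ range v := by
    rw [← hr1, ← hr2]
    simp only [Fin.range_cons]
    ext x
    simp only [mem_union, mem_insert_iff, mem_singleton_iff]
    tauto
  refine volume_polarDual_lt (by omega) hP (a := a) (b := b) (c := c) (e := e) (v := v) ?_ ?_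
    (hf1.of_range_eq hinj1 hr1) (hf2.of_range_eq hinj2 hr2) (by rwa [hr1]) (by rwa [hr2])
  · rw [hPconv, ← hunion, convexHull_convexHull_union_left, convexHull_convexHull_union_right]
  · rw [← hunion]
    rintro x (hx | hx)
    exacts [hlat x (hsub1 hx), hlat x (hsub2 hx)]
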